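/- Work in the single-node H∞ filtering setting. Suppose Y : [0,∞) → ℝ^{n×n} is differentiable, Y(t) is symmetric positive definite for every t ≥ 0 with α₁I ⪯ Y(t) ⪯ α₂I for some α₁, α₂ > 0, Y satisfies the filtering Riccati differential equation for every t ≥ 0, and Y(0) = X⁻¹ for a symmetric positive definite n×n matrix X. Let w(·), v(·), v_j(·), ε_j(·) (j ∈ J) be measurable signals on [0,∞) with finite total energy E := ∫₀^∞ (‖w(t)‖² + ‖v(t)‖² + Σ_{j∈J}(‖v_j(t)‖² + ‖W_jε_j(t)‖²_{Z_j⁻¹})) dt < ∞, and let e : [0,∞) → ℝⁿ be differentiable and satisfy for all t ≥ 0: e'(t) = (A(t) − L(t)C(t) − Σ_{j∈J} K_j(t)W_j)e(t) + Σ_{j∈J} K_j(t)W_jε_j(t) + B(t)w(t) − L(t)D(t)v(t) − Σ_{j∈J} K_j(t)H_jv_j(t). Then ∫₀^∞ e(t)ᵀR e(t) dt ≤ γ²(‖e(0)‖²_X + E). -/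

import Mathlib

open Matrix Finset MeasureTheory

theorem HasDerivAt.dotProduct {ι : Type*} [Fintype ι] {f g : ℝ → ι → ℝ} {f' g' : ι → ℝ} {t : ℝ}
    (hf : HasDerivAt f f' t) (hg : HasDerivAt g g' t) :
    HasDerivAt (fun s => f s ⬝ᵥ g s) (f' ⬝ᵥ g t + f t ⬝ᵥ g') t := by
  rw [hasDerivAt_pi] at hf hg
  simp only [_root_.dotProduct, ← Finset.sum_add_distrib]
  exact HasDerivAt.fun_sum fun i _ => (hf i).mul (hg i)

theorem HasDerivAt.mulVec {ι κ : Type*} [Fintype ι] [Fintype κ] {M : ℝ → Matrix ι κ ℝ}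
    {M' : Matrix ι κ ℝ} {f : ℝ → κ → ℝ} {f' : κ → ℝ} {t : ℝ}
    (hM : ∀ a b, HasDerivAt (fun s => M s a b) (M' a b) t) (hf : HasDerivAt f f' t) :
    HasDerivAt (fun s => M s *ᵥ f s) (M' *ᵥ f t + M t *ᵥ f') t := by
  rw [hasDerivAt_pi]
  exact fun i => (hasDerivAt_pi.2 (hM i)).dotProduct hf

theorem Matrix.differentiableAt_det {ι : Type*} [Fintype ι] [DecidableEq ι]
    {M : ℝ → Matrix ι ι ℝ} {t : ℝ} (hM : ∀ a b, DifferentiableAt ℝ (fun s => M s a b) t) :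
    DifferentiableAt ℝ (fun s => (M s).det) t := by
  simp only [det_apply]
  fun_prop

theorem Matrix.differentiableAt_inv_apply {ι : Type*} [Fintype ι] [DecidableEq ι]
    {M : ℝ → Matrix ι ι ℝ} {t : ℝ} (hM : ∀ a b, DifferentiableAt ℝ (fun s => M s a b) t)
    (hdet : (M t).det ≠ 0) (a b : ι) : DifferentiableAt ℝ (fun s => (M s)⁻¹ a b) t := by
  simp only [inv_def, Ring.inverse_eq_inv', smul_apply, smul_eq_mul, adjugate_apply]
  refine ((differentiableAt_det hM).inv hdet).mul (differentiableAt_det fun i j => ?_)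
  by_cases h : i = b
  · subst h
    simp
  · simpa [updateRow_ne h] using hM i j

/-- The derivative of the quadratic form `eᵀ Y⁻¹ e`, written in terms of `x = Y⁻¹ e`. -/
theorem Matrix.hasDerivAt_dotProduct_inv_mulVec {ι : Type*} [Fintype ι] [DecidableEq ι]
    {Y : ℝ → Matrix ι ι ℝ} {Y' : Matrix ι ι ℝ} {e : ℝ → ι → ℝ} {e' : ι → ℝ} {t : ℝ}
    (hY : ∀ a b, HasDerivAt (fun s => Y s a b) (Y' a b) t) (he : HasDerivAt e e' t)
    (hsymm : (Y t)ᵀ = Y t) (hdet : (Y t).det ≠ 0) :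
    HasDerivAt (fun s => e s ⬝ᵥ ((Y s)⁻¹ *ᵥ e s))
      (2 * (((Y t)⁻¹ *ᵥ e t) ⬝ᵥ e') - ((Y t)⁻¹ *ᵥ e t) ⬝ᵥ (Y' *ᵥ ((Y t)⁻¹ *ᵥ e t))) t := by
  have hYd : ∀ a b, DifferentiableAt ℝ (fun s => Y s a b) t := fun a b => (hY a b).differentiableAt
  have hx := HasDerivAt.mulVec (M' := of fun a b => deriv (fun s => (Y s)⁻¹ a b) t)
    (fun a b => (differentiableAt_inv_apply hYd hdet a b).hasDerivAt) he
  set x' := (of fun a b => deriv (fun s => (Y s)⁻¹ a b) t) *ᵥ e t + (Y t)⁻¹ *ᵥ e'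
  have hev : (fun s => Y s *ᵥ ((Y s)⁻¹ *ᵥ e s)) =ᶠ[nhds t] e := by
    filter_upwards [(differentiableAt_det hYd).continuousAt.eventually_ne hdet] with s hs
    rw [mulVec_mulVec, mul_nonsing_inv _ hs.isUnit, one_mulVec]
  have hYx : Y t *ᵥ ((Y t)⁻¹ *ᵥ e t) = e t := hev.eq_of_nhds
  have he' : e' = Y' *ᵥ ((Y t)⁻¹ *ᵥ e t) + Y t *ᵥ x' :=
    (he.congr_of_eventuallyEq hev).unique (HasDerivAt.mulVec hY hx)
  convert he.dotProduct hx using 1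
  have h1 : e t ⬝ᵥ x' = ((Y t)⁻¹ *ᵥ e t) ⬝ᵥ (Y t *ᵥ x') := by
    conv_lhs => rw [← hYx]
    rw [dotProduct_mulVec, ← mulVec_transpose, hsymm]
  have h2 := congrArg (((Y t)⁻¹ *ᵥ e t) ⬝ᵥ ·) he'
  simp only [dotProduct_add] at h2
  rw [h1, dotProduct_comm e']
  linarith

theorem Matrix.neg_dotProduct_mul_transpose_sub_le {ι κ : Type*} [Fintype ι] [Fintype κ]
    (H : Matrix ι κ ℝ) (y : ι → ℝ) (v : κ → ℝ) :
    -(y ⬝ᵥ ((H * Hᵀ) *ᵥ y)) - 2 * (y ⬝ᵥ (H *ᵥ v)) ≤ v ⬝ᵥ v := by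
  have h : 0 ≤ (v + Hᵀ *ᵥ y) ⬝ᵥ (v + Hᵀ *ᵥ y) := dotProduct_self_star_nonneg (v + Hᵀ *ᵥ y)
  have h1 : (Hᵀ *ᵥ y) ⬝ᵥ (Hᵀ *ᵥ y) = y ⬝ᵥ ((H * Hᵀ) *ᵥ y) := by
    rw [← mulVec_mulVec, dotProduct_mulVec y, ← mulVec_transpose]
  have h2 : (Hᵀ *ᵥ y) ⬝ᵥ v = y ⬝ᵥ (H *ᵥ v) := by
    rw [dotProduct_mulVec y, ← mulVec_transpose]
  simp only [add_dotProduct, dotProduct_add, dotProduct_comm v (Hᵀ *ᵥ y), h1, h2] at h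
  linarith

theorem Matrix.PosDef.two_mul_dotProduct_sub_le {ι : Type*} [Fintype ι] [DecidableEq ι]
    {Z : Matrix ι ι ℝ} (hZ : Z.PosDef) (y z : ι → ℝ) :
    2 * (y ⬝ᵥ z) - y ⬝ᵥ (Z *ᵥ y) ≤ z ⬝ᵥ (Z⁻¹ *ᵥ z) := by
  have h := hZ.posSemidef.dotProduct_mulVec_nonneg (Z⁻¹ *ᵥ z - y)
  have hs : Zᵀ = Z := hZ.isHermitian
  have hz : Z *ᵥ (Z⁻¹ *ᵥ z) = z := by
    rw [mulVec_mulVec, mul_nonsing_inv _ hZ.det_pos.ne'.isUnit, one_mulVec]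
  have h1 : (Z⁻¹ *ᵥ z) ⬝ᵥ (Z *ᵥ y) = z ⬝ᵥ y := by
    rw [dotProduct_mulVec, ← mulVec_transpose, hs, hz]
  simp only [star_trivial, mulVec_sub, hz, sub_dotProduct, dotProduct_sub, h1] at h
  rw [dotProduct_comm (Z⁻¹ *ᵥ z) z, dotProduct_comm z y] at h
  linarith

theorem Matrix.PosDef.dotProduct_transpose_mulVec_inv_mulVec {ι κ : Type*} [Fintype ι] [Fintype κ]
    [DecidableEq κ] {S : Matrix κ κ ℝ} (hS : S.PosDef) (N : Matrix κ ι ℝ) (e : ι → ℝ) (u : κ → ℝ) :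
    e ⬝ᵥ (Nᵀ *ᵥ (S⁻¹ *ᵥ u)) = (S⁻¹ *ᵥ (N *ᵥ e)) ⬝ᵥ u := by
  have hs : (S⁻¹)ᵀ = S⁻¹ := hS.isHermitian.inv
  rw [dotProduct_mulVec, vecMul_transpose, dotProduct_mulVec, ← mulVec_transpose, hs]

theorem Matrix.PosDef.mulVec_inv_mulVec {κ : Type*} [Fintype κ] [DecidableEq κ]
    {S : Matrix κ κ ℝ} (hS : S.PosDef) (u : κ → ℝ) : S *ᵥ (S⁻¹ *ᵥ u) = u := by
  rw [mulVec_mulVec, mul_nonsing_inv _ hS.det_pos.ne'.isUnit, one_mulVec]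

/-- The pointwise dissipation inequality: along the error dynamics, the derivative of the storage
function `eᵀ Y⁻¹ e` is at most the disturbance supply minus the weighted error. -/
theorem riccati_dissipation {ι κ ρ π J : Type*} [Fintype ι] [Fintype κ] [Fintype ρ]
    [Fintype π] [DecidableEq π] [Fintype J] {μ η : J → Type*} [∀ j, Fintype (μ j)]
    [∀ j, DecidableEq (μ j)] [∀ j, Fintype (η j)]
    (A Y R : Matrix ι ι ℝ) (B : Matrix ι κ ℝ) (C : Matrix π ι ℝ) (D : Matrix π ρ ℝ)
    (hD : (D * Dᵀ).PosDef) (c : ℝ) (W : (j : J) → Matrix (μ j) ι ℝ)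
    (H : (j : J) → Matrix (μ j) (η j) ℝ) (Z : (j : J) → Matrix (μ j) (μ j) ℝ)
    (hZ : ∀ j, (Z j).PosDef) (hY : Yᵀ = Y) (x e : ι → ℝ) (hx : Y *ᵥ x = e)
    (w : κ → ℝ) (v : ρ → ℝ) (vj : (j : J) → η j → ℝ) (ε : J → ι → ℝ) :
    2 * (x ⬝ᵥ ((A - Y * Cᵀ * (D * Dᵀ)⁻¹ * C
            - ∑ j, Y * (W j)ᵀ * (H j * (H j)ᵀ + Z j)⁻¹ * W j) *ᵥ e
          + (∑ j, (Y * (W j)ᵀ * (H j * (H j)ᵀ + Z j)⁻¹ * W j) *ᵥ ε j)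
          + B *ᵥ w - (Y * Cᵀ * (D * Dᵀ)⁻¹ * D) *ᵥ v
          - ∑ j, (Y * (W j)ᵀ * (H j * (H j)ᵀ + Z j)⁻¹ * H j) *ᵥ vj j))
      - x ⬝ᵥ ((A * Y + Y * Aᵀ + B * Bᵀ - Y * (Cᵀ * (D * Dᵀ)⁻¹ * C
          + (∑ j, (W j)ᵀ * (H j * (H j)ᵀ + Z j)⁻¹ * W j) - c • R) * Y) *ᵥ x)
    ≤ w ⬝ᵥ w + v ⬝ᵥ v + (∑ j, (vj j ⬝ᵥ vj j + (W j *ᵥ ε j) ⬝ᵥ ((Z j)⁻¹ *ᵥ (W j *ᵥ ε j))))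
      - c * (e ⬝ᵥ (R *ᵥ e)) := by
  have hU : ∀ j, (H j * (H j)ᵀ + Z j).PosDef := fun j => by
    have h : (H j * (H j)ᵀ).PosSemidef := by
      simpa using posSemidef_self_mul_conjTranspose (H j)
    exact PosDef.posSemidef_add h (hZ j)
  have hYx : ∀ u, x ⬝ᵥ (Y *ᵥ u) = e ⬝ᵥ u := fun u => by
    rw [dotProduct_mulVec, ← mulVec_transpose, hY, hx]
  have hAT : e ⬝ᵥ (Aᵀ *ᵥ x) = x ⬝ᵥ (A *ᵥ e) := by
    rw [dotProduct_mulVec, vecMul_transpose, dotProduct_comm]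
  have hw := neg_dotProduct_mul_transpose_sub_le B x (-w)
  have hv := neg_dotProduct_mul_transpose_sub_le D ((D * Dᵀ)⁻¹ *ᵥ (C *ᵥ e)) v
  rw [hD.mulVec_inv_mulVec] at hv
  simp only [mulVec_neg, dotProduct_neg, neg_dotProduct, neg_neg, ← mulVec_mulVec] at hw
  have hj : ∑ j, (2 * (e ⬝ᵥ ((W j)ᵀ *ᵥ ((H j * (H j)ᵀ + Z j)⁻¹ *ᵥ (W j *ᵥ ε j))))
        - 2 * (e ⬝ᵥ ((W j)ᵀ *ᵥ ((H j * (H j)ᵀ + Z j)⁻¹ *ᵥ (H j *ᵥ vj j))))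
        - e ⬝ᵥ ((W j)ᵀ *ᵥ ((H j * (H j)ᵀ + Z j)⁻¹ *ᵥ (W j *ᵥ e))))
      ≤ ∑ j, (vj j ⬝ᵥ vj j + (W j *ᵥ ε j) ⬝ᵥ ((Z j)⁻¹ *ᵥ (W j *ᵥ ε j))) := by
    refine Finset.sum_le_sum fun j _ => ?_
    simp only [(hU j).dotProduct_transpose_mulVec_inv_mulVec]
    set y := (H j * (H j)ᵀ + Z j)⁻¹ *ᵥ (W j *ᵥ e)
    have hy : W j *ᵥ e = (H j * (H j)ᵀ + Z j) *ᵥ y := ((hU j).mulVec_inv_mulVec _).symm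
    have h1 := neg_dotProduct_mul_transpose_sub_le (H j) y (vj j)
    have h2 := (hZ j).two_mul_dotProduct_sub_le y (W j *ᵥ ε j)
    rw [hy, add_mulVec, dotProduct_add]
    linarith
  simp only [Finset.sum_sub_distrib, ← Finset.mul_sum] at hj
  simp only [sub_mulVec, add_mulVec, sum_mulVec, smul_mulVec, dotProduct_sub, dotProduct_add,
    dotProduct_sum, dotProduct_smul, smul_eq_mul, ← mulVec_mulVec, hYx, hx, hAT,
    hD.dotProduct_transpose_mulVec_inv_mulVec]
  linarith

/-- Statement (iii) of Lemma 2 (inequality (8)): a single node of the distributed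
H∞ filter attenuates its local disturbances and the `Z⁻¹`-weighted influence of
its neighbors' errors:
`∫₀^∞ eᵀRe dt ≤ γ²(‖e(0)‖²_X + E)`. -/
theorem single_node_attenuation
    (n q r p : ℕ) (hn : 1 ≤ n)
    (J : Type) [Fintype J] (pj hj : J → ℕ)
    (A : ℝ → Matrix (Fin n) (Fin n) ℝ)
    (B : ℝ → Matrix (Fin n) (Fin q) ℝ)
    (C : ℝ → Matrix (Fin p) (Fin n) ℝ)
    (D : ℝ → Matrix (Fin p) (Fin r) ℝ)
    (hD : ∀ t : ℝ, 0 ≤ t → (D t * (D t)ᵀ).PosDef)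
    (γ : ℝ) (hγ : 0 < γ)
    (R : Matrix (Fin n) (Fin n) ℝ) (hR : R.PosDef)
    (X : Matrix (Fin n) (Fin n) ℝ) (hX : X.PosDef)
    (W : (j : J) → Matrix (Fin (pj j)) (Fin n) ℝ)
    (H : (j : J) → Matrix (Fin (pj j)) (Fin (hj j)) ℝ)
    (Z : (j : J) → Matrix (Fin (pj j)) (Fin (pj j)) ℝ)
    (hZ : ∀ j, (Z j).PosDef)
    (U : (j : J) → Matrix (Fin (pj j)) (Fin (pj j)) ℝ)
    (hU : ∀ j, U j = H j * (H j)ᵀ + Z j)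
    -- the bounded positive definite Riccati solution
    (Y : ℝ → Matrix (Fin n) (Fin n) ℝ)
    (hYpos : ∀ t : ℝ, 0 ≤ t → (Y t).PosDef)
    (α₁ α₂ : ℝ) (hα₁ : 0 < α₁) (hα₂ : 0 < α₂)
    (hYlb : ∀ t : ℝ, 0 ≤ t → (Y t - α₁ • (1 : Matrix (Fin n) (Fin n) ℝ)).PosSemidef)
    (hYub : ∀ t : ℝ, 0 ≤ t → (α₂ • (1 : Matrix (Fin n) (Fin n) ℝ) - Y t).PosSemidef)
    (hY0 : Y 0 = X⁻¹)
    -- the filtering Riccati differential equation (entrywise derivatives)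
    (hYder : ∀ t : ℝ, 0 ≤ t → ∀ a b : Fin n,
      HasDerivAt (fun s : ℝ => Y s a b)
        ((A t * Y t + Y t * (A t)ᵀ + B t * (B t)ᵀ
          - Y t * ((C t)ᵀ * (D t * (D t)ᵀ)⁻¹ * C t
              + (∑ j : J, (W j)ᵀ * (U j)⁻¹ * W j) - (γ ^ 2)⁻¹ • R) * Y t) a b) t)
    -- the injection gains
    (L : ℝ → Matrix (Fin n) (Fin p) ℝ)
    (hL : ∀ t : ℝ, 0 ≤ t → L t = Y t * (C t)ᵀ * (D t * (D t)ᵀ)⁻¹)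
    (K : (j : J) → ℝ → Matrix (Fin n) (Fin (pj j)) ℝ)
    (hK : ∀ (j : J) (t : ℝ), 0 ≤ t → K j t = Y t * (W j)ᵀ * (U j)⁻¹)
    -- measurable finite-energy signals
    (w : ℝ → Fin q → ℝ) (v : ℝ → Fin r → ℝ)
    (vj : (j : J) → ℝ → Fin (hj j) → ℝ) (ε : J → ℝ → Fin n → ℝ)
    (hwm : Measurable w) (hvm : Measurable v)
    (hvjm : ∀ j, Measurable (vj j)) (hεm : ∀ j, Measurable (ε j))
    (E : ℝ)
    (hEint : IntegrableOn (fun t : ℝ =>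
        w t ⬝ᵥ w t + v t ⬝ᵥ v t
          + ∑ j : J, (vj j t ⬝ᵥ vj j t
              + (W j *ᵥ ε j t) ⬝ᵥ ((Z j)⁻¹ *ᵥ (W j *ᵥ ε j t))))
      (Set.Ici (0 : ℝ)))
    (hE : E = ∫ t in Set.Ici (0 : ℝ),
        (w t ⬝ᵥ w t + v t ⬝ᵥ v t
          + ∑ j : J, (vj j t ⬝ᵥ vj j t
              + (W j *ᵥ ε j t) ⬝ᵥ ((Z j)⁻¹ *ᵥ (W j *ᵥ ε j t)))))
    -- the error trajectory and its dynamics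
    (e : ℝ → Fin n → ℝ)
    (he : ∀ t : ℝ, 0 ≤ t → HasDerivAt e
      ((A t - L t * C t - ∑ j : J, K j t * W j) *ᵥ e t
        + (∑ j : J, (K j t * W j) *ᵥ ε j t)
        + B t *ᵥ w t - (L t * D t) *ᵥ v t
        - ∑ j : J, (K j t * H j) *ᵥ vj j t) t) :
    IntegrableOn (fun t : ℝ => e t ⬝ᵥ (R *ᵥ e t)) (Set.Ici (0 : ℝ)) ∧
      (∫ t in Set.Ici (0 : ℝ), e t ⬝ᵥ (R *ᵥ e t))
        ≤ γ ^ 2 * (e 0 ⬝ᵥ (X *ᵥ e 0) + E) := by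
  have hdet : ∀ t, 0 ≤ t → (Y t).det ≠ 0 := fun t ht => (hYpos t ht).det_pos.ne'
  have hsymm : ∀ t, 0 ≤ t → (Y t)ᵀ = Y t := fun t ht => (hYpos t ht).isHermitian
  have hVder := fun t (ht : 0 ≤ t) =>
    hasDerivAt_dotProduct_inv_mulVec (hYder t ht) (he t ht) (hsymm t ht) (hdet t ht)
  set V : ℝ → ℝ := fun t => e t ⬝ᵥ ((Y t)⁻¹ *ᵥ e t)
  set g : ℝ → ℝ := fun t => w t ⬝ᵥ w t + v t ⬝ᵥ v t
          + ∑ j : J, (vj j t ⬝ᵥ vj j t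
              + (W j *ᵥ ε j t) ⬝ᵥ ((Z j)⁻¹ *ᵥ (W j *ᵥ ε j t)))
  set f : ℝ → ℝ := fun t => e t ⬝ᵥ (R *ᵥ e t)
  have hf0 : ∀ t, 0 ≤ f t := fun t => by
    simpa using hR.posSemidef.dotProduct_mulVec_nonneg (e t)
  have hg0 : ∀ t, 0 ≤ g t := fun t => by
    have h : ∀ {m : ℕ} (u : Fin m → ℝ), 0 ≤ u ⬝ᵥ u := fun u => dotProduct_self_star_nonneg u
    have hz : ∀ j, 0 ≤ (W j *ᵥ ε j t) ⬝ᵥ ((Z j)⁻¹ *ᵥ (W j *ᵥ ε j t)) := fun j => by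
      simpa using (hZ j).inv.posSemidef.dotProduct_mulVec_nonneg (W j *ᵥ ε j t)
    exact add_nonneg (add_nonneg (h _) (h _))
      (Finset.sum_nonneg fun j _ => add_nonneg (h _) (hz j))
  have hV0 : ∀ t, 0 ≤ t → 0 ≤ V t := fun t ht => by
    simpa using (hYpos t ht).inv.posSemidef.dotProduct_mulVec_nonneg (e t)
  have hVX : V 0 = e 0 ⬝ᵥ (X *ᵥ e 0) := by
    simp only [V, hY0, nonsing_inv_nonsing_inv _ hX.det_pos.ne'.isUnit]
  have hfcont : ContinuousOn f (Set.Ici 0) := fun t ht =>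
    ((he t ht).dotProduct (HasDerivAt.mulVec (M := fun _ => R) (M' := 0)
      (fun a b => hasDerivAt_const _ _) (he t ht))).continuousAt.continuousWithinAt
  have hfint : ∀ T, IntegrableOn f (Set.Icc 0 T) := fun T =>
    (hfcont.mono Set.Icc_subset_Ici_self).integrableOn_Icc
  have hgint : ∀ T, IntegrableOn g (Set.Icc 0 T) := fun T => hEint.mono_set Set.Icc_subset_Ici_self
  have hbound : ∀ T, 0 ≤ T → ∫ t in (0 : ℝ)..T, f t ≤ γ ^ 2 * (V 0 + E) := by
    intro T hT
    have h := intervalIntegral.sub_le_integral_of_hasDeriv_right_of_le (g := V)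
      (φ := fun t => g t - (γ ^ 2)⁻¹ * f t) hT
      (fun t ht => (hVder t ht.1).continuousAt.continuousWithinAt)
      (fun t ht => (hVder t ht.1.le).hasDerivWithinAt)
      ((hgint T).sub ((hfint T).const_mul _)) (fun t ht => by
        have hYx : Y t *ᵥ ((Y t)⁻¹ *ᵥ e t) = e t := (hYpos t ht.1.le).mulVec_inv_mulVec _
        have h := riccati_dissipation (A t) (Y t) R (B t) (C t) (D t) (hD t ht.1.le) (γ ^ 2)⁻¹
          W H Z hZ (hsymm t ht.1.le) _ _ hYx (w t) (v t) (fun j => vj j t) (fun j => ε j t)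
        simp only [hL t ht.1.le, hK _ t ht.1.le, hU]
        exact h)
    have hsub : ∫ t in (0 : ℝ)..T, (g t - (γ ^ 2)⁻¹ * f t)
        = (∫ t in (0 : ℝ)..T, g t) - (γ ^ 2)⁻¹ * ∫ t in (0 : ℝ)..T, f t := by
      rw [intervalIntegral.integral_sub, intervalIntegral.integral_const_mul]
      · exact (intervalIntegrable_iff_integrableOn_Icc_of_le hT).2 (hgint T)
      · exact ((intervalIntegrable_iff_integrableOn_Icc_of_le hT).2 (hfint T)).const_mul _
    have hgE : ∫ t in (0 : ℝ)..T, g t ≤ E := by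
      rw [intervalIntegral.integral_of_le hT, hE]
      exact setIntegral_mono_set hEint (Filter.Eventually.of_forall hg0)
        (Set.Ioc_subset_Icc_self.trans Set.Icc_subset_Ici_self).eventuallyLE
    have h1 : (γ ^ 2)⁻¹ * ∫ t in (0 : ℝ)..T, f t ≤ V 0 + E := by
      rw [hsub] at h
      linarith [hV0 T hT]
    rwa [inv_mul_le_iff₀ (by positivity)] at h1
  have hfIoi : IntegrableOn f (Set.Ioi 0) := by
    refine integrableOn_Ioi_of_intervalIntegral_norm_bounded (γ ^ 2 * (V 0 + E)) 0
      (fun T => (hfint T).mono_set Set.Ioc_subset_Icc_self) Filter.tendsto_id ?_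
    filter_upwards [Filter.eventually_ge_atTop 0] with T hT
    simpa only [id, Real.norm_of_nonneg (hf0 _)] using hbound T hT
  refine ⟨(integrableOn_Ici_iff_integrableOn_Ioi (by finiteness)).2 hfIoi, ?_⟩
  rw [integral_Ici_eq_integral_Ioi, ← hVX]
  refine le_of_tendsto (intervalIntegral_tendsto_integral_Ioi 0 hfIoi Filter.tendsto_id) ?_
  filter_upwards [Filter.eventually_ge_atTop 0] with T hT using hbound T hT
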